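/- Let C, D be positive natural numbers and let q, k : Fin C → ℝ be nonzero vectors. Let A be a random D × C matrix whose entries are independent standard Gaussian random variables, distributed according to the product measure ⨂_{i ∈ Fin D, j ∈ Fin C} N(0,1) on (Fin D → Fin C → ℝ). Define the binary embeddings q_s, k_s : Fin D → ({0,1} ⊆ ℝ) by q_s(i) = 1 if ∑_j A i j * q j > 0 and q_s(i) = 0 otherwise, and similarly for k_s with k in place of q. Then the expectation, with respect to the law of A, of f_H(q_s, k_s) equals g(f_C(q, k)). -/

import Mathlib

open MeasureTheory ProbabilityTheory

/-- Normalized Hamming similarity between two (binary) vectors in `Fin D → ℝ`. -/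
noncomputable def hammingSim {D : ℕ} (b b' : Fin D → ℝ) : ℝ :=
  1 - (1 / (D : ℝ)) * ((Finset.univ.filter (fun i => b i ≠ b' i)).card : ℝ)

/-- Cosine similarity between two vectors in `Fin C → ℝ`, with the Euclidean norm. -/
noncomputable def cosSim {C : ℕ} (x y : Fin C → ℝ) : ℝ :=
  (∑ j, x j * y j) / (Real.sqrt (∑ j, x j ^ 2) * Real.sqrt (∑ j, y j ^ 2))

/-- The monotone function `g x = 1 - (1/π) arccos x`. -/
noncomputable def g (x : ℝ) : ℝ := 1 - (1 / Real.pi) * Real.arccos x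

/-- Binary embedding of `q` by the random matrix `A`:
`(binEmbed A q) i = 1` if `∑ j, A i j * q j > 0` and `0` otherwise. -/
noncomputable def binEmbed {D C : ℕ} (A : Fin D → Fin C → ℝ) (q : Fin C → ℝ) :
    Fin D → ℝ :=
  fun i => if 0 < ∑ j, A i j * q j then 1 else 0

lemma charFunDual_map_pi_gaussianReal_pair {ι : Type*} [Fintype ι] (a b : ι → ℝ)
    (L : StrongDual ℝ (ℝ × ℝ)) :
    charFunDual ((Measure.pi fun _ : ι => gaussianReal 0 1).map
      (fun x => (∑ j, x j * a j, ∑ j, x j * b j))) L =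
    Complex.exp (-((L (1, 0) ^ 2 * ∑ j, a j ^ 2 + L (0, 1) ^ 2 * ∑ j, b j ^ 2 +
      2 * L (1, 0) * L (0, 1) * ∑ j, a j * b j : ℝ) : ℂ) / 2) := by
  have hL (s t : ℝ) : L (s, t) = s * L (1, 0) + t * L (0, 1) := by
    have : ((s, t) : ℝ × ℝ) = s • (1, 0) + t • (0, 1) := by simp
    rw [this, map_add, map_smul, map_smul, smul_eq_mul, smul_eq_mul]
  rw [charFunDual_apply, integral_map (Measurable.aemeasurable (by fun_prop))
    (Continuous.aestronglyMeasurable (by fun_prop))]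
  have hprod (x : ι → ℝ) :
      Complex.exp (L (∑ j, x j * a j, ∑ j, x j * b j) * Complex.I) =
        ∏ j, Complex.exp ((a j * L (1, 0) + b j * L (0, 1) : ℝ) * x j * Complex.I) := by
    rw [← Complex.exp_sum, hL, ← Finset.sum_mul, Finset.sum_mul, Finset.sum_mul,
      ← Finset.sum_add_distrib]
    push_cast
    congr 2
    exact Finset.sum_congr rfl fun j _ => by ring
  simp_rw [hprod]
  rw [integral_fintype_prod_eq_prod (𝕜 := ℂ) (fun j (y : ℝ) =>
    Complex.exp ((a j * L (1, 0) + b j * L (0, 1) : ℝ) * y * Complex.I))]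
  simp_rw [← charFun_apply_real, charFun_gaussianReal]
  rw [← Complex.exp_sum]
  congr 1
  push_cast
  rw [Finset.mul_sum, Finset.mul_sum, Finset.mul_sum, ← Finset.sum_add_distrib,
    ← Finset.sum_add_distrib, ← Finset.sum_neg_distrib, Finset.sum_div]
  exact Finset.sum_congr rfl fun j _ => by simp; ring

/-- The law of a pair of linear functionals of a standard Gaussian vector only depends on the Gram
matrix of the two functionals. -/
lemma map_pi_gaussianReal_pair_eq_of_gram_eq {ι κ : Type*} [Fintype ι] [Fintype κ]
    {u v : ι → ℝ} {u' v' : κ → ℝ} (huu : ∑ j, u j ^ 2 = ∑ j, u' j ^ 2)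
    (hvv : ∑ j, v j ^ 2 = ∑ j, v' j ^ 2) (huv : ∑ j, u j * v j = ∑ j, u' j * v' j) :
    (Measure.pi fun _ : ι => gaussianReal 0 1).map
        (fun x => (∑ j, x j * u j, ∑ j, x j * v j)) =
      (Measure.pi fun _ : κ => gaussianReal 0 1).map
        (fun x => (∑ j, x j * u' j, ∑ j, x j * v' j)) := by
  have := Measure.isProbabilityMeasure_map (μ := Measure.pi fun _ : ι => gaussianReal 0 1)
    (f := fun x => (∑ j, x j * u j, ∑ j, x j * v j)) (by fun_prop)
  have := Measure.isProbabilityMeasure_map (μ := Measure.pi fun _ : κ => gaussianReal 0 1)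
    (f := fun x => (∑ j, x j * u' j, ∑ j, x j * v' j)) (by fun_prop)
  refine Measure.ext_of_charFunDual (funext fun L => ?_)
  rw [charFunDual_map_pi_gaussianReal_pair, charFunDual_map_pi_gaussianReal_pair, huu, hvv, huv]

lemma gaussianPDF_mul_cos_mul_gaussianPDF_mul_sin (r φ : ℝ) :
    gaussianPDF 0 1 (r * Real.cos φ) * gaussianPDF 0 1 (r * Real.sin φ) =
      gaussianPDF 0 1 r * gaussianPDF 0 1 0 := by
  simp only [gaussianPDF]
  rw [← ENNReal.ofReal_mul (gaussianPDFReal_nonneg _ _ _),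
    ← ENNReal.ofReal_mul (gaussianPDFReal_nonneg _ _ _)]
  congr 1
  simp only [gaussianPDFReal]
  rw [mul_mul_mul_comm, ← Real.exp_add, mul_mul_mul_comm _ _ _ (Real.exp _), ← Real.exp_add]
  congr 2
  simp only [NNReal.coe_one]
  linear_combination (-r ^ 2 / 2) * Real.sin_sq_add_cos_sq φ

/-- The standard Gaussian measure on the plane has a uniformly distributed polar angle. -/
lemma prod_gaussianReal_apply_of_angle {S : Set (ℝ × ℝ)} (hS : MeasurableSet S) {T : Set ℝ}
    (hT : MeasurableSet T)
    (hST : ∀ r φ : ℝ, 0 < r → ((r * Real.cos φ, r * Real.sin φ) ∈ S ↔ φ ∈ T)) :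
    ((gaussianReal 0 1).prod (gaussianReal 0 1)) S =
      volume (T ∩ Set.Ioo (-Real.pi) Real.pi) / ENNReal.ofReal (2 * Real.pi) := by
  set R : ENNReal :=
    ∫⁻ r in Set.Ioi (0 : ℝ), ENNReal.ofReal r * (gaussianPDF 0 1 r * gaussianPDF 0 1 0)
  have polar {S : Set (ℝ × ℝ)} (hS : MeasurableSet S) {T : Set ℝ} (hT : MeasurableSet T)
      (hST : ∀ r φ : ℝ, 0 < r → ((r * Real.cos φ, r * Real.sin φ) ∈ S ↔ φ ∈ T)) :
      ((gaussianReal 0 1).prod (gaussianReal 0 1)) S =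
        R * volume (T ∩ Set.Ioo (-Real.pi) Real.pi) := by
    rw [gaussianReal_of_var_ne_zero 0 one_ne_zero,
      prod_withDensity (measurable_gaussianPDF _ _) (measurable_gaussianPDF _ _),
      withDensity_apply _ hS, ← lintegral_indicator hS, ← Measure.volume_eq_prod,
      ← lintegral_comp_polarCoord_symm]
    have hcongr : ∀ p ∈ polarCoord.target,
        ENNReal.ofReal p.1 • S.indicator
            (fun z : ℝ × ℝ => gaussianPDF 0 1 z.1 * gaussianPDF 0 1 z.2) (polarCoord.symm p) =
          (ENNReal.ofReal p.1 * (gaussianPDF 0 1 p.1 * gaussianPDF 0 1 0)) *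
            T.indicator 1 p.2 := by
      rintro ⟨r, φ⟩ hp
      have hr : 0 < r := hp.1
      by_cases hφ : φ ∈ T
      · simp [polarCoord_symm_apply, (hST r φ hr).2 hφ, hφ,
          gaussianPDF_mul_cos_mul_gaussianPDF_mul_sin]
      · simp [polarCoord_symm_apply, (hST r φ hr).not.2 hφ, hφ]
    rw [setLIntegral_congr_fun polarCoord.open_target.measurableSet hcongr, polarCoord_target,
      Measure.volume_eq_prod, ← Measure.prod_restrict,
      lintegral_prod_mul (f := fun r => ENNReal.ofReal r * (gaussianPDF 0 1 r * gaussianPDF 0 1 0))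
        (by fun_prop) (measurable_one.indicator hT).aemeasurable,
      lintegral_indicator_one hT, Measure.restrict_apply hT]
  have hR_mul : R * ENNReal.ofReal (2 * Real.pi) = 1 := by
    have h := polar (S := Set.univ) (T := Set.univ) .univ .univ (by simp)
    rw [measure_univ, Set.univ_inter, Real.volume_Ioo] at h
    rw [h]
    congr 2
    ring
  rw [polar hS hT hST, mul_comm, ENNReal.eq_inv_of_mul_eq_one_left hR_mul, div_eq_mul_inv]

lemma volume_cos_pos_cos_sub_nonpos {θ : ℝ} (hθ₀ : 0 ≤ θ) (hθ : θ ≤ Real.pi) :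
    volume ({φ : ℝ | 0 < Real.cos φ ∧ Real.cos (φ - θ) ≤ 0} ∩ Set.Ioo (-Real.pi) Real.pi) =
      ENNReal.ofReal θ := by
  have hπ := Real.pi_pos
  apply le_antisymm
  · calc _ ≤ volume (Set.Ioc (-(Real.pi / 2)) (θ - Real.pi / 2)) := by
          refine measure_mono ?_
          rintro φ ⟨⟨hcos, hcos_sub⟩, hφ₁, hφ₂⟩
          have h₁ : -(Real.pi / 2) < φ := by
            by_contra! h
            have := Real.cos_nonpos_of_pi_div_two_le_of_le (x := -φ) (by linarith) (by linarith)
            rw [Real.cos_neg] at this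
            linarith
          have h₂ : φ < Real.pi / 2 := by
            by_contra! h
            have := Real.cos_nonpos_of_pi_div_two_le_of_le h (by linarith)
            linarith
          refine ⟨h₁, ?_⟩
          by_contra! h
          have := Real.cos_pos_of_mem_Ioo (x := φ - θ) ⟨by linarith, by linarith⟩
          linarith
      _ = ENNReal.ofReal θ := by rw [Real.volume_Ioc]; congr 1; ring
  · calc ENNReal.ofReal θ = volume (Set.Ioo (-(Real.pi / 2)) (θ - Real.pi / 2)) := by
          rw [Real.volume_Ioo]; congr 1; ring
      _ ≤ _ := by
          refine measure_mono ?_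
          rintro φ ⟨hφ₁, hφ₂⟩
          refine ⟨⟨Real.cos_pos_of_mem_Ioo ⟨hφ₁, by linarith⟩, ?_⟩, by linarith, by linarith⟩
          rw [← Real.cos_neg]
          exact Real.cos_nonpos_of_pi_div_two_le_of_le (by linarith) (by linarith)

lemma cosSim_comm {C : ℕ} (x y : Fin C → ℝ) : cosSim x y = cosSim y x := by
  simp only [cosSim, mul_comm]

lemma sqrt_sum_sq_pos {ι : Type*} [Fintype ι] {x : ι → ℝ} (hx : x ≠ 0) :
    0 < Real.sqrt (∑ j, x j ^ 2) := by
  obtain ⟨j, hj⟩ := Function.ne_iff.1 hx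
  exact Real.sqrt_pos.2 (Finset.sum_pos' (fun i _ => sq_nonneg _)
    ⟨j, Finset.mem_univ j, sq_pos_iff.2 hj⟩)

lemma abs_cosSim_le_one {C : ℕ} (x y : Fin C → ℝ) : |cosSim x y| ≤ 1 := by
  rw [cosSim, abs_div, abs_of_nonneg (a := _ * _) (by positivity)]
  refine div_le_one_of_le₀ ?_ (by positivity)
  rw [← Real.sqrt_mul (Finset.sum_nonneg fun _ _ => sq_nonneg _)]
  exact Real.abs_le_sqrt (Finset.sum_mul_sq_le_sq_mul_sq _ _ _)

lemma measurableSet_pos_nonpos : MeasurableSet {z : ℝ × ℝ | 0 < z.1 ∧ z.2 ≤ 0} :=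
  (measurableSet_lt measurable_const measurable_fst).inter
    (measurableSet_le measurable_snd measurable_const)

lemma pi_gaussianReal_pos_nonpos {C : ℕ} {q k : Fin C → ℝ} (hq : q ≠ 0) (hk : k ≠ 0) :
    (Measure.pi fun _ : Fin C => gaussianReal 0 1).real
        {x | 0 < ∑ j, x j * q j ∧ ∑ j, x j * k j ≤ 0} =
      Real.arccos (cosSim q k) / (2 * Real.pi) := by
  set θ := Real.arccos (cosSim q k)
  set a := Real.sqrt (∑ j, q j ^ 2) with ha
  set b := Real.sqrt (∑ j, k j ^ 2) with hb
  have ha₀ : 0 < a := sqrt_sum_sq_pos hq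
  have hb₀ : 0 < b := sqrt_sum_sq_pos hk
  have hcos : Real.cos θ = cosSim q k :=
    Real.cos_arccos (abs_le.1 (abs_cosSim_le_one q k)).1 (abs_le.1 (abs_cosSim_le_one q k)).2
  have hgram := map_pi_gaussianReal_pair_eq_of_gram_eq
    (u := q) (v := k) (u' := ![a, 0]) (v' := ![b * Real.cos θ, b * Real.sin θ])
    (by simp [ha, Real.sq_sqrt (Finset.sum_nonneg fun _ _ => sq_nonneg _)])
    (by
      have h : b ^ 2 = ∑ j, k j ^ 2 := Real.sq_sqrt (Finset.sum_nonneg fun _ _ => sq_nonneg _)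
      simp only [Fin.sum_univ_two, Matrix.cons_val_zero, Matrix.cons_val_one]
      linear_combination -h - b ^ 2 * Real.sin_sq_add_cos_sq θ)
    (by
      simp only [Fin.sum_univ_two, Matrix.cons_val_zero, Matrix.cons_val_one, hcos, cosSim]
      rw [← ha, ← hb]
      field_simp
      ring)
  have hQ := measurableSet_pos_nonpos
  have hplane := congrArg (fun μ : Measure (ℝ × ℝ) => μ {z | 0 < z.1 ∧ z.2 ≤ 0}) hgram
  simp only [Fin.sum_univ_two, Matrix.cons_val_zero, Matrix.cons_val_one] at hplane
  rw [Measure.map_apply (by fun_prop) hQ, Measure.map_apply (by fun_prop) hQ] at hplane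
  set S : Set (ℝ × ℝ) :=
    {z | 0 < z.1 * a + z.2 * 0 ∧ z.1 * (b * Real.cos θ) + z.2 * (b * Real.sin θ) ≤ 0} with hS
  have hSm : MeasurableSet S :=
    hQ.preimage (f := fun z : ℝ × ℝ =>
      (z.1 * a + z.2 * 0, z.1 * (b * Real.cos θ) + z.2 * (b * Real.sin θ))) (by fun_prop)
  have hpres := measurePreserving_finTwoArrow (gaussianReal 0 1)
  have hTm : MeasurableSet {φ : ℝ | 0 < Real.cos φ ∧ Real.cos (φ - θ) ≤ 0} :=
    hQ.preimage (f := fun φ => (Real.cos φ, Real.cos (φ - θ))) (by fun_prop)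
  have hSθ := prod_gaussianReal_apply_of_angle hSm hTm (by
    intro r φ hr
    have h₁ : r * Real.cos φ * a + r * Real.sin φ * 0 = (r * a) * Real.cos φ := by ring
    have h₂ : r * Real.cos φ * (b * Real.cos θ) + r * Real.sin φ * (b * Real.sin θ) =
        (r * b) * Real.cos (φ - θ) := by rw [Real.cos_sub]; ring
    simp only [hS, Set.mem_ofPred_eq, h₁, h₂, ← not_lt (a := (0 : ℝ)),
      mul_pos_iff_of_pos_left (mul_pos hr ha₀), mul_pos_iff_of_pos_left (mul_pos hr hb₀)])
  rw [volume_cos_pos_cos_sub_nonpos (Real.arccos_nonneg _) (Real.arccos_le_pi _),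
    ← hpres.measure_preimage hSm.nullMeasurableSet] at hSθ
  rw [measureReal_def]
  change ((Measure.pi fun _ : Fin C => gaussianReal 0 1) ((fun x : Fin C → ℝ =>
    (∑ j, x j * q j, ∑ j, x j * k j)) ⁻¹' {z | 0 < z.1 ∧ z.2 ≤ 0})).toReal = _
  rw [hplane]
  refine (congrArg ENNReal.toReal hSθ).trans ?_
  rw [ENNReal.toReal_div, ENNReal.toReal_ofReal (Real.arccos_nonneg _),
    ENNReal.toReal_ofReal (by positivity)]

lemma pi_gaussianReal_sign_ne {C : ℕ} {q k : Fin C → ℝ} (hq : q ≠ 0) (hk : k ≠ 0) :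
    (Measure.pi fun _ : Fin C => gaussianReal 0 1).real
        {x | ¬(0 < ∑ j, x j * q j ↔ 0 < ∑ j, x j * k j)} =
      Real.arccos (cosSim q k) / Real.pi := by
  have hunion : {x : Fin C → ℝ | ¬(0 < ∑ j, x j * q j ↔ 0 < ∑ j, x j * k j)} =
      {x | 0 < ∑ j, x j * q j ∧ ∑ j, x j * k j ≤ 0} ∪
        {x | 0 < ∑ j, x j * k j ∧ ∑ j, x j * q j ≤ 0} := by
    ext x
    simp only [Set.mem_ofPred_eq, Set.mem_union, ← not_lt]
    tauto
  have hdisj : Disjoint {x : Fin C → ℝ | 0 < ∑ j, x j * q j ∧ ∑ j, x j * k j ≤ 0}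
      {x | 0 < ∑ j, x j * k j ∧ ∑ j, x j * q j ≤ 0} :=
    Set.disjoint_left.2 fun x hx hx' => hx.1.not_ge hx'.2
  have hmeas : MeasurableSet {x : Fin C → ℝ | 0 < ∑ j, x j * k j ∧ ∑ j, x j * q j ≤ 0} :=
    measurableSet_pos_nonpos.preimage
      (f := fun x : Fin C → ℝ => (∑ j, x j * k j, ∑ j, x j * q j)) (by fun_prop)
  rw [hunion, measureReal_union hdisj hmeas, pi_gaussianReal_pos_nonpos hq hk,
    pi_gaussianReal_pos_nonpos hk hq, cosSim_comm k q]
  field_simp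
  ring

lemma hammingSim_binEmbed {C D : ℕ} (A : Fin D → Fin C → ℝ) (q k : Fin C → ℝ) :
    hammingSim (binEmbed A q) (binEmbed A k) = 1 - (1 / (D : ℝ)) * ∑ i,
      {x : Fin C → ℝ | ¬(0 < ∑ j, x j * q j ↔ 0 < ∑ j, x j * k j)}.indicator
        (fun _ => (1 : ℝ)) (A i) := by
  rw [hammingSim, Finset.card_filter, Nat.cast_sum]
  congr 2
  refine Finset.sum_congr rfl fun i _ => ?_
  simp only [binEmbed, Set.indicator_apply, Set.mem_ofPred_eq]
  by_cases h₁ : 0 < ∑ j, A i j * q j <;> by_cases h₂ : 0 < ∑ j, A i j * k j <;> simp [h₁, h₂]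

theorem stmt_3 (C D : ℕ) (hC : 0 < C) (hD : 0 < D)
    (q k : Fin C → ℝ) (hq : q ≠ 0) (hk : k ≠ 0) :
    (∫ A : Fin D → Fin C → ℝ,
        hammingSim (binEmbed A q) (binEmbed A k)
        ∂(Measure.pi fun _ : Fin D => Measure.pi fun _ : Fin C => gaussianReal 0 1))
      = g (cosSim q k) := by
  set W : Set (Fin C → ℝ) := {x | ¬(0 < ∑ j, x j * q j ↔ 0 < ∑ j, x j * k j)} with hW
  have hWm : MeasurableSet W := by
    have h (w : Fin C → ℝ) : MeasurableSet {x : Fin C → ℝ | 0 < ∑ j, x j * w j} :=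
      measurableSet_lt (by fun_prop) (by fun_prop)
    exact ((h q).iff (h k)).compl
  have hrow (i : Fin D) := measurePreserving_eval
    (fun _ : Fin D => Measure.pi fun _ : Fin C => gaussianReal 0 1) i
  have hint : Integrable (W.indicator fun _ => (1 : ℝ))
      (Measure.pi fun _ : Fin C => gaussianReal 0 1) := (integrable_const 1).indicator hWm
  have hinti (i : Fin D) : Integrable
      (fun A : Fin D → Fin C → ℝ => W.indicator (fun _ => (1 : ℝ)) (A i))
      (Measure.pi fun _ : Fin D => Measure.pi fun _ : Fin C => gaussianReal 0 1) :=
    (hrow i).integrable_comp_of_integrable hint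
  have hexp (i : Fin D) : ∫ A : Fin D → Fin C → ℝ, W.indicator (fun _ => (1 : ℝ)) (A i)
      ∂(Measure.pi fun _ : Fin D => Measure.pi fun _ : Fin C => gaussianReal 0 1) =
        Real.arccos (cosSim q k) / Real.pi := by
    rw [← pi_gaussianReal_sign_ne hq hk, ← hW, ← integral_indicator_one hWm]
    exact (integral_map (hrow i).aemeasurable
      (measurable_const.indicator hWm).aestronglyMeasurable).symm.trans (by rw [(hrow i).map_eq]; rfl)
  simp_rw [hammingSim_binEmbed]
  rw [integral_sub (integrable_const _) ((integrable_finsetSum _ fun i _ => hinti i).const_mul _),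
    integral_const_mul, integral_finsetSum _ fun i _ => hinti i]
  simp_rw [hexp]
  have : (D : ℝ) ≠ 0 := by positivity
  simp only [integral_const, probReal_univ, Finset.sum_const, Finset.card_univ, Fintype.card_fin,
    nsmul_eq_mul, smul_eq_mul, g]
  field_simp
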